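/- arXiv:2210.06693 — 3 statements merged into one kernel-verified Lean document; each statement's English description precedes it below -/
import Mathlib

section
/- Let E be a complex inner product space and let Π and Λ be orthogonal projections on E. Let v ∈ E be a unit vector with Λ v = v, and suppose (Λ ∘ Π ∘ Λ) v = p • v for some real number p. Then for every integer m ≥ 1: ‖((Π ∘ Λ)^m) v‖² = p^{2m−1} and ‖((Λ ∘ Π)^m) v‖² = p^{2m}. -/
theorem stmt_4 {E : Type*} [NormedAddCommGroup E] [InnerProductSpace ℂ E]
    (Pr La : Module.End ℂ E)
    (hPr : Pr * Pr = Pr)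
    (hPrSym : ∀ x y : E, (inner ℂ (Pr x) y : ℂ) = inner ℂ x (Pr y))
    (hLa : La * La = La)
    (hLaSym : ∀ x y : E, (inner ℂ (La x) y : ℂ) = inner ℂ x (La y))
    (v : E) (hv : ‖v‖ = 1) (hLav : La v = v)
    (p : ℝ) (hp : (La * Pr * La) v = (p : ℂ) • v) :
    ∀ m : ℕ, 1 ≤ m →
      ‖((Pr * La) ^ m) v‖ ^ 2 = p ^ (2 * m - 1) ∧
      ‖((La * Pr) ^ m) v‖ ^ 2 = p ^ (2 * m) := by
  have h1 : La (Pr v) = (p : ℂ) • v := by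
    simpa [Module.End.mul_apply, hLav] using hp
  have hPP : Pr (Pr v) = Pr v := by
    rw [← Module.End.mul_apply, hPr]
  have hn : ‖Pr v‖ ^ 2 = p := by
    have h2 : (inner ℂ (Pr v) (Pr v) : ℂ) = (p : ℂ) := by
      rw [hPrSym, hPP]
      calc (inner ℂ v (Pr v) : ℂ) = inner ℂ (La v) (Pr v) := by rw [hLav]
        _ = (p : ℂ) := by
          rw [hLaSym, h1, inner_smul_right, inner_self_eq_norm_sq_to_K, hv]
          simp
    rw [inner_self_eq_norm_sq_to_K] at h2
    have h3 : (((‖Pr v‖ ^ 2 : ℝ)) : ℂ) = (p : ℂ) := by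
      rw [← h2]
      simp
    exact Complex.ofReal_injective h3
  have hA : ∀ k : ℕ, ((La * Pr) ^ k) v = ((p : ℂ) ^ k) • v := by
    intro k
    induction k with
    | zero => simp
    | succ k ih =>
      rw [pow_succ', Module.End.mul_apply, ih, map_smul, Module.End.mul_apply, h1, smul_smul,
        pow_succ]
  have hB : ∀ k : ℕ, ((Pr * La) ^ (k + 1)) v = ((p : ℂ) ^ k) • Pr v := by
    intro k
    induction k with
    | zero => simp [Module.End.mul_apply, hLav]
    | succ k ih =>
      rw [pow_succ', Module.End.mul_apply, ih, map_smul, Module.End.mul_apply, h1, map_smul,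
        smul_smul, pow_succ]
  intro m hm
  obtain ⟨k, rfl⟩ : ∃ k, m = k + 1 := ⟨m - 1, by omega⟩
  have habs : ∀ j : ℕ, (‖(p : ℂ) ^ j‖) ^ 2 = p ^ (2 * j) := by
    intro j
    rw [norm_pow, Complex.norm_real, Real.norm_eq_abs, ← pow_mul, mul_comm j 2, pow_mul, sq_abs,
      ← pow_mul]
  constructor
  · rw [hB, norm_smul, mul_pow, hn, habs, ← pow_succ]
    congr 1
  · rw [hA, norm_smul, mul_pow, hv, habs]
    simp
end

section
/- Let E be a complex inner product space and let Π and Λ be orthogonal projections on E. Let (φ_i)_{i ∈ I} be a finite orthonormal family in E such that for every i, Λ φ_i = φ_i and (Λ ∘ Π ∘ Λ) φ_i = p_i • φ_i for nonnegative reals p_i. Let v = Σ_{i ∈ I} α_i • φ_i with complex coefficients α_i. Then for every integer m ≥ 1: ‖((Π ∘ Λ)^m) v‖² = Σ_{i ∈ I} |α_i|² p_i^{2m−1} and ‖((Λ ∘ Π)^m) v‖² = Σ_{i ∈ I} |α_i|² p_i^{2m}. -/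
theorem stmt_5 {E : Type*} [NormedAddCommGroup E] [InnerProductSpace ℂ E]
    {I : Type*} [Fintype I]
    (Pr La : Module.End ℂ E)
    (hPr : Pr * Pr = Pr)
    (hPrSym : ∀ x y : E, (inner ℂ (Pr x) y : ℂ) = inner ℂ x (Pr y))
    (hLa : La * La = La)
    (hLaSym : ∀ x y : E, (inner ℂ (La x) y : ℂ) = inner ℂ x (La y))
    (φ : I → E) (hortho : Orthonormal ℂ φ)
    (p : I → ℝ) (hp : ∀ i, 0 ≤ p i)
    (hLaφ : ∀ i, La (φ i) = φ i)
    (heig : ∀ i, (La * Pr * La) (φ i) = (p i : ℂ) • φ i)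
    (α : I → ℂ) (v : E) (hv : v = ∑ i, α i • φ i) :
    ∀ m : ℕ, 1 ≤ m →
      ‖((Pr * La) ^ m) v‖ ^ 2 = ∑ i, ‖α i‖ ^ 2 * p i ^ (2 * m - 1) ∧
      ‖((La * Pr) ^ m) v‖ ^ 2 = ∑ i, ‖α i‖ ^ 2 * p i ^ (2 * m) := by
  have h1 : ∀ i, La (Pr (φ i)) = (p i : ℂ) • φ i := by
    intro i
    have h := heig i
    simpa [Module.End.mul_apply, hLaφ] using h
  have hw : ∀ m : ℕ, ((La * Pr) ^ m) v = ∑ i, (α i * (p i : ℂ) ^ m) • φ i := by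
    intro m
    induction m with
    | zero => simp [hv]
    | succ k ih =>
      rw [pow_succ', Module.End.mul_apply, ih, map_sum]
      refine Finset.sum_congr rfl fun i _ => ?_
      rw [map_smul, Module.End.mul_apply, h1, smul_smul, pow_succ, mul_assoc]
  have hLaw : ∀ m : ℕ, La (((La * Pr) ^ m) v) = ((La * Pr) ^ m) v := by
    intro m
    rw [hw, map_sum]
    exact Finset.sum_congr rfl fun i _ => by rw [map_smul, hLaφ]
  have hinner : ∀ a b : ℕ, (inner ℂ (((La * Pr) ^ a) v) (((La * Pr) ^ b) v) : ℂ)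
      = ((∑ i, ‖α i‖ ^ 2 * p i ^ (a + b) : ℝ) : ℂ) := by
    intro a b
    rw [hw, hw, hortho.inner_sum]
    push_cast
    refine Finset.sum_congr rfl fun i _ => ?_
    rw [← Complex.conj_mul' (α i), map_mul, map_pow, Complex.conj_ofReal, pow_add]
    ring
  have hnorm : ∀ x : E, ∀ r : ℝ, (inner ℂ x x : ℂ) = (r : ℂ) → ‖x‖ ^ 2 = r := by
    intro x r h
    have h2 := congrArg Complex.re h
    rw [Complex.ofReal_re] at h2
    rw [← h2]
    exact (inner_self_eq_norm_sq (𝕜 := ℂ) x).symm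
  have hshift : ∀ k : ℕ, (Pr * La) ^ (k + 1) = Pr * (La * Pr) ^ k * La := by
    intro k
    induction k with
    | zero => simp
    | succ k ih => rw [pow_succ, ih, pow_succ (La * Pr)]; simp only [mul_assoc]
  intro m hm
  obtain ⟨k, rfl⟩ : ∃ k, m = k + 1 := ⟨m - 1, by omega⟩
  refine ⟨hnorm _ _ ?_, hnorm _ _ ?_⟩
  · have hv1 : La v = v := by simpa using hLaw 0
    have e : ((Pr * La) ^ (k + 1)) v = Pr (((La * Pr) ^ k) v) := by
      rw [hshift, Module.End.mul_apply, Module.End.mul_apply, hv1]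
    have hPP : ∀ x, Pr (Pr x) = Pr x := fun x => by
      rw [← Module.End.mul_apply, hPr]
    have e2 : La (Pr (((La * Pr) ^ k) v)) = ((La * Pr) ^ (k + 1)) v := by
      rw [pow_succ', Module.End.mul_apply, Module.End.mul_apply]
    rw [e, hPrSym, hPP, ← hLaw k, hLaSym, hLaw k, e2, hinner]
    have : k + (k + 1) = 2 * (k + 1) - 1 := by omega
    rw [this]
  · rw [hinner, two_mul]
end

section
/- Let E be a complex inner product space and let T be a linear map on E that is symmetric (⟨T x, y⟩ = ⟨x, T y⟩ for all x, y) and positive semidefinite (Re⟨x, T x⟩ ≥ 0 for all x). Then for every v ∈ E and every integer k ≥ 1, the numbers a_k := Re⟨v, T^k v⟩ satisfy a_k² ≤ a_{k−1} · a_{k+1}, where a_0 := ‖v‖². In particular the sequence of ratios a_{k+1}/a_k is non-decreasing wherever it is defined. -/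
theorem stmt_7 {E : Type*} [NormedAddCommGroup E] [InnerProductSpace ℂ E]
    (T : Module.End ℂ E)
    (hTSym : ∀ x y : E, (inner ℂ (T x) y : ℂ) = inner ℂ x (T y))
    (hTpos : ∀ x : E, 0 ≤ (inner ℂ x (T x) : ℂ).re)
    (v : E) (a : ℕ → ℝ)
    (ha0 : a 0 = ‖v‖ ^ 2)
    (ha : ∀ k : ℕ, 1 ≤ k → a k = (inner ℂ v ((T ^ k) v) : ℂ).re) :
    (∀ k : ℕ, 1 ≤ k → a k ^ 2 ≤ a (k - 1) * a (k + 1)) ∧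
    (∀ k : ℕ, 1 ≤ k → a (k - 1) ≠ 0 → a k ≠ 0 →
      a k / a (k - 1) ≤ a (k + 1) / a k) := by
  have hmove : ∀ (m : ℕ) (x y : E), (inner ℂ ((T ^ m) x) y : ℂ) = inner ℂ x ((T ^ m) y) := by
    intro m
    induction m with
    | zero => intro x y; simp
    | succ m ih =>
      intro x y
      rw [pow_succ', Module.End.mul_apply, hTSym, ih, ← Module.End.mul_apply, ← pow_succ,
        ← pow_succ']
  have hpos : ∀ (n : ℕ) (x : E), 0 ≤ (inner ℂ x ((T ^ n) x) : ℂ).re := by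
    intro n x
    rcases Nat.even_or_odd' n with ⟨m, rfl | rfl⟩
    · rw [two_mul, pow_add, Module.End.mul_apply, ← hmove]
      exact inner_self_nonneg (𝕜 := ℂ)
    · have h := hTpos ((T ^ m) x)
      rw [hmove, ← Module.End.mul_apply, ← Module.End.mul_apply, ← pow_succ, ← pow_add] at h
      rwa [show 2 * m + 1 = m + 1 + m by ring]
  have hb : ∀ k : ℕ, a k = (inner ℂ v ((T ^ k) v) : ℂ).re := by
    intro k
    rcases Nat.eq_zero_or_pos k with rfl | hk
    · rw [ha0, pow_zero, Module.End.one_apply]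
      exact (inner_self_eq_norm_sq (𝕜 := ℂ) v).symm
    · exact ha k hk
  have hnn : ∀ k, 0 ≤ a k := fun k => by rw [hb]; exact hpos k v
  have key : ∀ n : ℕ, a (n + 1) ^ 2 ≤ a n * a (n + 2) := by
    intro n
    have hq : ∀ t : ℝ, 0 ≤ a (n + 2) * (t * t) + (2 * a (n + 1)) * t + a n := by
      intro t
      have h := hpos n (v + (t : ℂ) • T v)
      have e1 : (T ^ n) (T v) = (T ^ (n + 1)) v := by
        rw [pow_succ, Module.End.mul_apply]
      have e2 : (inner ℂ (T v) ((T ^ n) v) : ℂ) = inner ℂ v ((T ^ (n + 1)) v) := by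
        rw [hTSym, pow_succ', Module.End.mul_apply]
      have e3 : (inner ℂ (T v) ((T ^ (n + 1)) v) : ℂ) = inner ℂ v ((T ^ (n + 2)) v) := by
        rw [hTSym, pow_succ' T (n + 1), Module.End.mul_apply]
      rw [map_add, map_smul, e1, inner_add_left, inner_add_right, inner_add_right,
        inner_smul_left, inner_smul_left, inner_smul_right, inner_smul_right, e2, e3,
        Complex.conj_ofReal] at h
      simp only [Complex.add_re, Complex.re_ofReal_mul, ← hb] at h
      linarith
    have hd := discrim_le_zero hq
    unfold discrim at hd
    linarith
  have main : ∀ k : ℕ, 1 ≤ k → a k ^ 2 ≤ a (k - 1) * a (k + 1) := by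
    intro k hk
    obtain ⟨n, rfl⟩ := Nat.exists_eq_add_of_le' hk
    exact key n
  refine ⟨main, fun k hk h0 h1 => ?_⟩
  have p0 := lt_of_le_of_ne (hnn (k - 1)) h0.symm
  have p1 := lt_of_le_of_ne (hnn k) h1.symm
  rw [div_le_div_iff₀ p0 p1]
  have := main k hk
  linarith
end
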